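/- arXiv:2002.12604 — 2 statements merged into one kernel-verified Lean document; each statement's English description precedes it below -/
import Mathlib

section
/- Let I ⊆ J be finite sets of natural numbers and let j be a natural number with j ∉ J. Then σ({j},J) · σ(I, J∖I) = σ({j},I) · σ(I∪{j}, J∖I). (This is the key permutation identity, Equation (36), used in the paper's proof of the Stokes theorem for the circulation, Theorem 1.) -/
/-- Number of "inversion" pairs (a,b) ∈ A × B with b < a. -/
def invCount (A B : Finset ℕ) : ℕ :=
  ((A ×ˢ B).filter (fun p => p.2 < p.1)).card

/-- The signature σ(A,B) = (−1)^{N(A,B)} of the permutation sorting the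
concatenation of the increasing enumerations of A and B. -/
def sortSign (A B : Finset ℕ) : ℤ :=
  (-1) ^ invCount A B

theorem invCount_union_left {A B : Finset ℕ} (h : Disjoint A B) (C : Finset ℕ) :
    invCount (A ∪ B) C = invCount A C + invCount B C := by
  unfold invCount
  rw [Finset.union_product, Finset.filter_union, Finset.card_union_of_disjoint]
  exact Finset.disjoint_filter_filter (Finset.disjoint_product.mpr (Or.inl h))

theorem invCount_union_right (A : Finset ℕ) {B C : Finset ℕ} (h : Disjoint B C) :
    invCount A (B ∪ C) = invCount A B + invCount A C := by
  unfold invCount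
  rw [Finset.product_union, Finset.filter_union, Finset.card_union_of_disjoint]
  exact Finset.disjoint_filter_filter (Finset.disjoint_product.mpr (Or.inr h))

theorem circulation_signature_identity (I J : Finset ℕ) (j : ℕ)
    (hIJ : I ⊆ J) (hj : j ∉ J) :
    sortSign {j} J * sortSign I (J \ I) =
      sortSign {j} I * sortSign (I ∪ {j}) (J \ I) := by
  have hJ : invCount {j} J = invCount {j} I + invCount {j} (J \ I) := by
    rw [← invCount_union_right {j} Finset.disjoint_sdiff, Finset.union_sdiff_of_subset hIJ]
  have hI : Disjoint I {j} := Finset.disjoint_singleton_right.mpr fun h => hj (hIJ h)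
  simp only [sortSign, hJ, invCount_union_left hI, pow_add]
  ring
end

section
/- Let C and J be disjoint finite sets of natural numbers and let j ∈ C. Then σ({j},J) · σ(C∖{j}, J∪{j}) = σ(C∖{j},{j}) · σ(C,J). (This is the second permutation identity, illustrated in Figure 3, used in the paper's proof of the Stokes theorem for the flux, Theorem 2, with C playing the role of J^c.) -/
theorem sortSign_union_left {A A' : Finset ℕ} (B : Finset ℕ) (h : Disjoint A A') :
    sortSign (A ∪ A') B = sortSign A B * sortSign A' B := by
  unfold sortSign invCount
  rw [← pow_add, Finset.union_product, Finset.filter_union, Finset.card_union_of_disjoint]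
  exact Finset.disjoint_filter_filter (Finset.disjoint_product.2 (Or.inl h))

theorem sortSign_union_right (A : Finset ℕ) {B B' : Finset ℕ} (h : Disjoint B B') :
    sortSign A (B ∪ B') = sortSign A B * sortSign A B' := by
  unfold sortSign invCount
  rw [← pow_add, Finset.product_union, Finset.filter_union, Finset.card_union_of_disjoint]
  exact Finset.disjoint_filter_filter (Finset.disjoint_product.2 (Or.inr h))

theorem flux_signature_identity_fig3 (C J : Finset ℕ) (j : ℕ)
    (hCJ : Disjoint C J) (hj : j ∈ C) :
    sortSign {j} J * sortSign (C \ {j}) (J ∪ {j}) =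
      sortSign (C \ {j}) {j} * sortSign C J := by
  have hJ : Disjoint J {j} :=
    Finset.disjoint_singleton_right.2 (Finset.disjoint_left.1 hCJ hj)
  have hC : sortSign C J = sortSign (C \ {j}) J * sortSign {j} J := by
    rw [← sortSign_union_left J Finset.sdiff_disjoint,
      Finset.sdiff_union_of_subset (Finset.singleton_subset_iff.2 hj)]
  rw [sortSign_union_right _ hJ, hC]
  ring
end
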